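/- Moser-type commutator estimate: for all integers n ≥ 1 and s ≥ 1 there exists a constant c_s > 0 with the following property. If u, v : ℝⁿ → ℝ are s-times continuously differentiable and all partial derivatives of u and of v of order at most s are bounded and square-integrable on ℝⁿ, then for every multi-index α with |α| ≤ s one has ‖∂^α(u v) − u ∂^α v‖_{L²(ℝⁿ)} ≤ c_s ( ‖∇u‖_{L^∞} ‖v‖_{W^{s−1,2}} + ‖v‖_{L^∞} ‖u‖_{W^{s,2}} ), where ‖∇u‖_{L^∞} = max_{1≤i≤n} ‖∂_i u‖_{L^∞}. -/

import Mathlib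

open MeasureTheory Finset

/-- Partial derivative in the `i`-th coordinate direction. -/
noncomputable def pd {n : ℕ} (i : Fin n) (f : (Fin n → ℝ) → ℝ) : (Fin n → ℝ) → ℝ :=
  fun x => fderiv ℝ f x (Pi.single i 1)

/-- Classical partial derivative `∂^α` for a multi-index `α`. -/
noncomputable def mderiv {n : ℕ} (α : Fin n → ℕ) (f : (Fin n → ℝ) → ℝ) : (Fin n → ℝ) → ℝ :=
  (List.ofFn fun i : Fin n => (pd i)^[α i]).foldr (· ∘ ·) id f

/-- The finite set of multi-indices `α` with `|α| ≤ s`. -/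
def multiIndices (n s : ℕ) : Finset (Fin n → ℕ) :=
  (Fintype.piFinset fun _ : Fin n => Finset.range (s + 1)).filter fun α => ∑ i, α i ≤ s

/-- The `L²(ℝⁿ)` norm. -/
noncomputable def L2norm {n : ℕ} (f : (Fin n → ℝ) → ℝ) : ℝ :=
  Real.sqrt (∫ x, f x ^ 2)

/-- The `L^∞(ℝⁿ)` norm (for bounded functions). -/
noncomputable def LinfNorm {n : ℕ} (f : (Fin n → ℝ) → ℝ) : ℝ :=
  ⨆ x, |f x|

/-- The Sobolev norm `‖f‖_{W^{s,2}}`. -/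
noncomputable def sobNorm (n s : ℕ) (f : (Fin n → ℝ) → ℝ) : ℝ :=
  Real.sqrt (∑ α ∈ multiIndices n s, ∫ x, mderiv α f x ^ 2)

/-- Iterated partial derivatives along a word. -/
noncomputable def DD {n : ℕ} : List (Fin n) → ((Fin n → ℝ) → ℝ) → ((Fin n → ℝ) → ℝ)
  | [], f => f
  | i :: l, f => pd i (DD l f)

lemma DD_append {n : ℕ} (a b : List (Fin n)) (f : (Fin n → ℝ) → ℝ) :
    DD (a ++ b) f = DD a (DD b f) := by
  induction a with
  | nil => rfl
  | cons i a ih => simp [DD, ih]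

lemma DD_replicate {n : ℕ} (k : ℕ) (i : Fin n) (f : (Fin n → ℝ) → ℝ) :
    DD (List.replicate k i) f = (pd i)^[k] f := by
  induction k with
  | zero => rfl
  | succ k ih => rw [List.replicate_succ, DD, ih, Function.iterate_succ_apply']

/-- The ordered word of a multi-index. -/
def wordOf {n : ℕ} (α : Fin n → ℕ) : List (Fin n) :=
  (List.ofFn fun i => List.replicate (α i) i).flatten

lemma mderiv_eq {n : ℕ} (α : Fin n → ℕ) (f : (Fin n → ℝ) → ℝ) :
    mderiv α f = DD (wordOf α) f := by
  have key : ∀ L : List (Fin n), (L.map fun i => (pd i)^[α i]).foldr (· ∘ ·) id f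
      = DD ((L.map fun i => List.replicate (α i) i).flatten) f := by
    intro L
    induction L with
    | nil => rfl
    | cons i L ih =>
      simp only [List.map_cons, List.foldr_cons, List.flatten_cons, Function.comp_apply, ih,
        DD_append, DD_replicate]
  simp only [mderiv, wordOf, List.ofFn_eq_map]
  exact key _

lemma count_wordOf {n : ℕ} (α : Fin n → ℕ) (j : Fin n) : (wordOf α).count j = α j := by
  simp [wordOf, List.count_flatten, List.map_ofFn, List.sum_ofFn, List.count_replicate]

lemma length_wordOf {n : ℕ} (α : Fin n → ℕ) : (wordOf α).length = ∑ i, α i := by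
  simp [wordOf, List.length_flatten, List.map_ofFn, List.sum_ofFn]

lemma mem_multiIndices {n s : ℕ} (α : Fin n → ℕ) : α ∈ multiIndices n s ↔ ∑ i, α i ≤ s := by
  simp only [multiIndices, Finset.mem_filter, Fintype.mem_piFinset, Finset.mem_range,
    and_iff_right_iff_imp]
  intro h i
  have := Finset.single_le_sum (f := α) (fun _ _ => Nat.zero_le _) (Finset.mem_univ i)
  omega

lemma pd_contDiff {n k : ℕ} (i : Fin n) {f : (Fin n → ℝ) → ℝ} (hf : ContDiff ℝ (k + 1 : ℕ) f) :
    ContDiff ℝ k (pd i f) := by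
  have : ContDiff ℝ k (fderiv ℝ f) := hf.fderiv_right (by norm_cast)
  exact this.clm_apply contDiff_const

lemma DD_contDiff {n : ℕ} (l : List (Fin n)) : ∀ {k : ℕ} {f : (Fin n → ℝ) → ℝ},
    ContDiff ℝ (k + l.length : ℕ) f → ContDiff ℝ k (DD l f) := by
  induction l with
  | nil => intro k f hf; simpa [DD] using hf
  | cons i l ih =>
    intro k f hf
    apply pd_contDiff
    apply ih
    convert hf using 2
    simp only [List.length_cons]; ring

lemma DD_contDiff' {n : ℕ} (l : List (Fin n)) {k m : ℕ} {f : (Fin n → ℝ) → ℝ}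
    (hf : ContDiff ℝ m f) (h : k + l.length ≤ m) : ContDiff ℝ k (DD l f) :=
  DD_contDiff l (hf.of_le (by exact_mod_cast h))

lemma pd_comm {n : ℕ} (i j : Fin n) {f : (Fin n → ℝ) → ℝ} (hf : ContDiff ℝ (2 : ℕ) f) :
    pd i (pd j f) = pd j (pd i f) := by
  have h1 : ContDiff ℝ 1 (fderiv ℝ f) := hf.fderiv_right (by norm_num)
  have h2 : Differentiable ℝ (fderiv ℝ f) := h1.differentiable (by norm_num)
  have key : ∀ (a b : Fin n) x, pd a (pd b f) x
      = fderiv ℝ (fderiv ℝ f) x (Pi.single a 1) (Pi.single b 1) := by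
    intro a b x
    unfold pd
    rw [fderiv_clm_apply (h2 x) (differentiableAt_const _)]
    simp
  funext x
  rw [key, key]
  exact (hf.contDiffAt.isSymmSndFDerivAt (by simp)) _ _

lemma DD_perm {n m : ℕ} {l l' : List (Fin n)} (h : l.Perm l') {f : (Fin n → ℝ) → ℝ}
    (hf : ContDiff ℝ m f) (hl : l.length ≤ m) : DD l f = DD l' f := by
  induction h with
  | nil => rfl
  | cons x h ih => simp only [DD]; rw [ih (by simp at hl; omega)]
  | swap x y l =>
    simp only [DD]
    simp only [List.length_cons] at hl
    exact pd_comm _ _ (DD_contDiff' l hf (by omega))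
  | trans h1 h2 ih1 ih2 => rw [ih1 hl, ih2 (by rw [← h1.length_eq]; exact hl)]

lemma DD_eq_mderiv {n m : ℕ} (l : List (Fin n)) {f : (Fin n → ℝ) → ℝ}
    (hf : ContDiff ℝ m f) (hl : l.length ≤ m) :
    ∃ α : Fin n → ℕ, ∑ i, α i = l.length ∧ DD l f = mderiv α f := by
  have hp : l.Perm (wordOf fun i => l.count i) := by
    rw [List.perm_iff_count]
    intro a
    rw [count_wordOf]
  refine ⟨fun i => l.count i, ?_, ?_⟩
  · rw [← length_wordOf, hp.length_eq]
  · rw [mderiv_eq]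
    exact DD_perm hp hf hl

lemma DD_smul {n : ℕ} (l : List (Fin n)) (c : ℝ) (f : (Fin n → ℝ) → ℝ) :
    DD l (fun x => c * f x) = fun x => c * DD l f x := by
  induction l with
  | nil => rfl
  | cons i l ih =>
    simp only [DD, ih]
    funext x
    unfold pd
    have := fderiv_const_smul_field (𝕜 := ℝ) (R := ℝ) c (f := DD l f)
    have h2 : (fun x => c * DD l f x) = c • DD l f := by ext; simp
    rw [h2, this]
    simp

/-- Leibniz-type expansion of the commutator. -/
lemma leibniz {n : ℕ} (l : List (Fin n)) :
    ∃ L : List (List (Fin n) × List (Fin n)),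
      (∀ p ∈ L, p.1 ≠ [] ∧ p.1.length + p.2.length = l.length) ∧ L.length + 1 ≤ 2 ^ l.length ∧
      ∀ (u v : (Fin n → ℝ) → ℝ), ContDiff ℝ l.length u → ContDiff ℝ l.length v →
        ∀ x, DD l (fun y => u y * v y) x
          = u x * DD l v x + (L.map fun p => DD p.1 u x * DD p.2 v x).sum := by
  induction l with
  | nil => exact ⟨[], by simp, by simp, by intros; simp [DD]⟩
  | cons i l ih =>
    obtain ⟨L, h1, h2, h3⟩ := ih
    refine ⟨([i], l) :: (L.map (fun p => (i :: p.1, p.2)) ++ L.map (fun p => (p.1, i :: p.2))),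
      ?_, ?_, ?_⟩
    · intro p hp
      simp only [List.mem_cons, List.mem_append, List.mem_map] at hp
      rcases hp with rfl | ⟨q, hq, rfl⟩ | ⟨q, hq, rfl⟩
      · simp; omega
      · have := h1 q hq; simp; omega
      · have := h1 q hq; simp [this.1]; omega
    · simp [pow_succ]; omega
    · intro u v hu hv x
      have hu' : ContDiff ℝ l.length u := hu.of_le (by simp)
      have hv' : ContDiff ℝ l.length v := hv.of_le (by simp)
      have hdiff : ∀ (a : List (Fin n)) (f : (Fin n → ℝ) → ℝ), a.length ≤ l.length →
          ContDiff ℝ (i :: l).length f → Differentiable ℝ (DD a f) := by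
        intro a f ha hf
        exact (DD_contDiff' (k := 1) a hf (by simp; omega)).differentiable (by norm_num)
      have hpd : ∀ (f g : (Fin n → ℝ) → ℝ), Differentiable ℝ f → Differentiable ℝ g →
          pd i (fun y => f y * g y) x = f x * pd i g x + pd i f x * g x := by
        intro f g hf hg
        unfold pd
        rw [fderiv_fun_mul (hf x) (hg x)]
        simp; ring
      have hsum : ∀ L' : List (List (Fin n) × List (Fin n)),
          (∀ p ∈ L', p.1.length + p.2.length = l.length) →
          Differentiable ℝ (fun y => (L'.map fun p => DD p.1 u y * DD p.2 v y).sum) ∧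
          pd i (fun y => (L'.map fun p => DD p.1 u y * DD p.2 v y).sum) x
            = (L'.map fun p => DD (i :: p.1) u x * DD p.2 v x).sum
              + (L'.map fun p => DD p.1 u x * DD (i :: p.2) v x).sum := by
        intro L'
        induction L' with
        | nil => intro _; simp [pd]
        | cons p L' ih =>
          intro hp
          have hp0 := hp p (by simp)
          obtain ⟨ih1, ih2⟩ := ih (fun q hq => hp q (by simp [hq]))
          have d1 := hdiff p.1 u (by omega) hu
          have d2 := hdiff p.2 v (by omega) hv
          simp only [List.map_cons, List.sum_cons]
          refine ⟨(d1.mul d2).add ih1, ?_⟩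
          have : pd i (fun y => DD p.1 u y * DD p.2 v y
              + (L'.map fun p => DD p.1 u y * DD p.2 v y).sum) x
              = pd i (fun y => DD p.1 u y * DD p.2 v y) x
              + pd i (fun y => (L'.map fun p => DD p.1 u y * DD p.2 v y).sum) x := by
            unfold pd
            rw [fderiv_fun_add ((d1.fun_mul d2) x) (ih1 x)]
            simp
          rw [this, ih2, hpd _ _ d1 d2]
          simp only [DD]
          ring
      obtain ⟨s1, s2⟩ := hsum L (fun p hp => (h1 p hp).2)
      have e : DD l (fun y => u y * v y) = fun x =>
          u x * DD l v x + (L.map fun p => DD p.1 u x * DD p.2 v x).sum :=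
        funext (h3 u v hu' hv')
      have d1 : Differentiable ℝ u := hdiff [] u (by simp) hu
      have d2 := hdiff l v le_rfl hv
      rw [DD, e]
      have : pd i (fun y => u y * DD l v y
          + (L.map fun p => DD p.1 u y * DD p.2 v y).sum) x
          = pd i (fun y => u y * DD l v y) x
          + pd i (fun y => (L.map fun p => DD p.1 u y * DD p.2 v y).sum) x := by
        unfold pd
        rw [fderiv_fun_add ((d1.fun_mul d2) x) (s1 x)]
        simp
      rw [this, s2, hpd _ _ d1 d2]
      simp only [List.map_cons, List.sum_cons, List.map_append, List.sum_append, List.map_map,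
        Function.comp_def, DD]
      ring

lemma young3 {w1 w2 w3 : ℝ} (h1 : 0 < w1) (h2 : 0 < w2) (h3 : 0 < w3) (hw : w1 + w2 + w3 = 1)
    {ε : ℝ} (hε : 0 < ε) : ∃ C : ℝ, 0 < C ∧ ∀ a b c : ℝ, 0 ≤ a → 0 ≤ b → 0 ≤ c →
      a * b * c ≤ ε * a ^ (1 / w1) + ε * b ^ (1 / w2) + C * c ^ (1 / w3) := by
  refine ⟨ε ^ (-((w1 + w2) / w3)), Real.rpow_pos_of_pos hε _, ?_⟩
  intro a b c ha hb hc
  set K := ε ^ (-((w1 + w2) / w3)) with hK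
  have hK0 : 0 < K := Real.rpow_pos_of_pos hε _
  have pa := Real.rpow_nonneg ha (1 / w1)
  have pb := Real.rpow_nonneg hb (1 / w2)
  have pc := Real.rpow_nonneg hc (1 / w3)
  have := Real.geom_mean_le_arith_mean3_weighted h1.le h2.le h3.le (mul_nonneg hε.le pa)
    (mul_nonneg hε.le pb) (mul_nonneg hK0.le pc) hw
  rw [Real.mul_rpow hε.le pa, Real.mul_rpow hε.le pb, Real.mul_rpow hK0.le pc,
    ← Real.rpow_mul ha, ← Real.rpow_mul hb, ← Real.rpow_mul hc, one_div_mul_cancel h1.ne',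
    one_div_mul_cancel h2.ne', one_div_mul_cancel h3.ne', Real.rpow_one, Real.rpow_one,
    Real.rpow_one, hK, ← Real.rpow_mul hε.le] at this
  have e : ε ^ w1 * ε ^ w2 * ε ^ (-((w1 + w2) / w3) * w3) = 1 := by
    rw [← Real.rpow_add hε, ← Real.rpow_add hε]
    have : w1 + w2 + -((w1 + w2) / w3) * w3 = 0 := by field_simp; ring
    rw [this, Real.rpow_zero]
  have e2 : ε ^ w1 * a * (ε ^ w2 * b) * (ε ^ (-((w1 + w2) / w3) * w3) * c) = a * b * c := by
    calc _ = (ε ^ w1 * ε ^ w2 * ε ^ (-((w1 + w2) / w3) * w3)) * (a * b * c) := by ring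
      _ = _ := by rw [e, one_mul]
  rw [e2, ← hK] at this
  have q1 := mul_le_of_le_one_left (mul_nonneg hε.le pa) (by linarith : w1 ≤ 1)
  have q2 := mul_le_of_le_one_left (mul_nonneg hε.le pb) (by linarith : w2 ≤ 1)
  have q3 := mul_le_of_le_one_left (mul_nonneg hK0.le pc) (by linarith : w3 ≤ 1)
  linarith

lemma young2 {w2 w3 : ℝ} (h2 : 0 < w2) (h3 : 0 < w3) (hw : w2 + w3 = 1)
    {ε : ℝ} (hε : 0 < ε) : ∃ C : ℝ, 0 < C ∧ ∀ b c : ℝ, 0 ≤ b → 0 ≤ c →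
      b * c ≤ ε * b ^ (1 / w2) + C * c ^ (1 / w3) := by
  refine ⟨ε ^ (-(w2 / w3)), Real.rpow_pos_of_pos hε _, ?_⟩
  intro b c hb hc
  set K := ε ^ (-(w2 / w3)) with hK
  have hK0 : 0 < K := Real.rpow_pos_of_pos hε _
  have pb := Real.rpow_nonneg hb (1 / w2)
  have pc := Real.rpow_nonneg hc (1 / w3)
  have := Real.geom_mean_le_arith_mean2_weighted h2.le h3.le
    (mul_nonneg hε.le pb) (mul_nonneg hK0.le pc) hw
  rw [Real.mul_rpow hε.le pb, Real.mul_rpow hK0.le pc,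
    ← Real.rpow_mul hb, ← Real.rpow_mul hc,
    one_div_mul_cancel h2.ne', one_div_mul_cancel h3.ne', Real.rpow_one,
    Real.rpow_one, hK, ← Real.rpow_mul hε.le] at this
  have e : ε ^ w2 * ε ^ (-(w2 / w3) * w3) = 1 := by
    rw [← Real.rpow_add hε]
    have : w2 + -(w2 / w3) * w3 = 0 := by field_simp; ring
    rw [this, Real.rpow_zero]
  have e2 : ε ^ w2 * b * (ε ^ (-(w2 / w3) * w3) * c) = b * c := by
    calc _ = (ε ^ w2 * ε ^ (-(w2 / w3) * w3)) * (b * c) := by ring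
      _ = _ := by rw [e, one_mul]
  rw [e2, ← hK] at this
  have q2 := mul_le_of_le_one_left (mul_nonneg hε.le pb) (by linarith : w2 ≤ 1)
  have q3 := mul_le_of_le_one_left (mul_nonneg hK0.le pc) (by linarith : w3 ≤ 1)
  linarith

lemma hasDerivAt_psi {p : ℝ} (hp : 0 < p) (t : ℝ) :
    HasDerivAt (fun t : ℝ => |t| ^ p * t) ((p + 1) * |t| ^ p) t := by
  rcases eq_or_ne t 0 with rfl | ht
  · rw [abs_zero, Real.zero_rpow hp.ne', mul_zero, hasDerivAt_iff_tendsto_slope]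
    have h1 : Filter.Tendsto (fun t : ℝ => |t| ^ p) (nhdsWithin 0 {0}ᶜ) (nhds 0) := by
      have : Continuous (fun t : ℝ => |t| ^ p) :=
        continuous_abs.rpow_const (fun _ => Or.inr hp.le)
      have h := this.tendsto 0
      simp only [abs_zero, Real.zero_rpow hp.ne'] at h
      exact h.mono_left nhdsWithin_le_nhds
    refine h1.congr' ?_
    filter_upwards [self_mem_nhdsWithin] with y hy
    have hy : y ≠ 0 := hy
    simp [slope]
    field_simp
  · have h1 := (hasDerivAt_abs ht).rpow_const (p := p) (Or.inl (abs_ne_zero.mpr ht))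
    have h2 := h1.mul (hasDerivAt_id t)
    refine HasDerivAt.congr_deriv (f := fun t : ℝ => |t| ^ p * t) h2 ?_
    have h3 : |t| ^ p = |t| ^ (p - 1) * |t| := by
      rw [← Real.rpow_add_one (abs_ne_zero.mpr ht)]; ring_nf
    have h4 : (SignType.sign t : ℝ) * t = |t| := by
      rw [sign_mul_self]
    change SignType.sign t * p * |t| ^ (p - 1) * t + |t| ^ p * 1 = (p + 1) * |t| ^ p
    linear_combination -p * h3 + p * |t| ^ (p - 1) * h4

/-- Bounded, continuous and square integrable. -/
structure Good {n : ℕ} (f : (Fin n → ℝ) → ℝ) : Prop where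
  cont : Continuous f
  bdd : ∃ C, ∀ x, |f x| ≤ C
  sq : Integrable fun x => f x ^ 2

lemma Good.bdd' {n : ℕ} {f : (Fin n → ℝ) → ℝ} (hf : Good f) : ∃ C, 0 < C ∧ ∀ x, |f x| ≤ C := by
  obtain ⟨C, hC⟩ := hf.bdd
  exact ⟨max C 1, by positivity, fun x => (hC x).trans (le_max_left _ _)⟩

lemma Good.rpow {n : ℕ} {f : (Fin n → ℝ) → ℝ} (hf : Good f) {q : ℝ} (hq : 2 ≤ q) :
    Integrable fun x => |f x| ^ q := by
  obtain ⟨C, hC0, hC⟩ := hf.bdd'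
  refine Integrable.mono' (hf.sq.const_mul (C ^ (q - 2)))
    (hf.cont.abs.rpow_const (fun _ => Or.inr (by linarith))).aestronglyMeasurable
    (Filter.Eventually.of_forall fun x => ?_)
  rw [Real.norm_of_nonneg (by positivity)]
  have : |f x| ^ q = |f x| ^ (q - 2) * f x ^ 2 := by
    rw [← sq_abs, ← Real.rpow_natCast (|f x|) 2, ← Real.rpow_add_of_nonneg (abs_nonneg _)
      (by linarith) (by norm_num)]
    norm_num
  rw [this]
  gcongr
  exact hC x

lemma Good.mul {n : ℕ} {f g w : (Fin n → ℝ) → ℝ} (hf : Good f) (hg : Good g)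
    (hw : Continuous w) (hb : ∃ C, ∀ x, |w x| ≤ C) :
    Integrable fun x => f x * w x * g x := by
  obtain ⟨C, hC⟩ := hb
  refine Integrable.mono' ((hf.sq.add hg.sq).const_mul (C))
    ((hf.cont.mul hw).mul hg.cont).aestronglyMeasurable
    (Filter.Eventually.of_forall fun x => ?_)
  rw [Real.norm_eq_abs, abs_mul, abs_mul]
  have h0 : 0 ≤ C := (abs_nonneg _).trans (hC x)
  have : |f x| * |g x| ≤ f x ^ 2 + g x ^ 2 := by
    rw [← sq_abs (f x), ← sq_abs (g x)]
    nlinarith [sq_nonneg (|f x| - |g x|), sq_nonneg (|f x|), sq_nonneg (|g x|)]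
  calc _ = |w x| * (|f x| * |g x|) := by ring
    _ ≤ C * (f x ^ 2 + g x ^ 2) := by gcongr; exact hC x

lemma ibp_ineq {n : ℕ} (i : Fin n) {h : (Fin n → ℝ) → ℝ} (hc : ContDiff ℝ (2 : ℕ) h)
    (h0 : Good h) (h1 : Good (pd i h)) (h2 : Good (pd i (pd i h))) {q : ℝ} (hq : 2 < q) :
    Integrable (fun x => |h x| * |pd i h x| ^ (q - 2) * |pd i (pd i h) x|) ∧
    ∫ x, |pd i h x| ^ q ≤
      (q - 1) * ∫ x, |h x| * |pd i h x| ^ (q - 2) * |pd i (pd i h) x| := by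
  have hp : 0 < q - 2 := by linarith
  set g := pd i h with hg
  have hgc : ContDiff ℝ (1 : ℕ) g := pd_contDiff i hc
  have hgd : Differentiable ℝ g := hgc.differentiable (by norm_num)
  have hhd : Differentiable ℝ h := hc.differentiable (by norm_num)
  have wc : Continuous (fun x => |g x| ^ (q - 2)) :=
    h1.cont.abs.rpow_const (fun _ => Or.inr hp.le)
  have wb : ∃ C, ∀ x, |(|g x| ^ (q - 2))| ≤ C := by
    obtain ⟨C, hC0, hC⟩ := h1.bdd'
    refine ⟨C ^ (q - 2), fun x => ?_⟩
    rw [abs_of_nonneg (by positivity)]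
    exact Real.rpow_le_rpow (abs_nonneg _) (hC x) hp.le
  have hder : ∀ x, HasFDerivAt (fun x => |g x| ^ (q - 2) * g x)
      (((q - 2 + 1) * |g x| ^ (q - 2)) • fderiv ℝ g x) x := fun x =>
    (hasDerivAt_psi hp (g x)).comp_hasFDerivAt x (hgd x).hasFDerivAt
  have i3 := h0.mul h2 wc wb
  have i3' : Integrable (fun x => |h x| * |g x| ^ (q - 2) * |pd i g x|) := by
    refine i3.norm.congr (Filter.Eventually.of_forall fun x => ?_)
    simp only [Real.norm_eq_abs, abs_mul]
    rw [abs_of_nonneg (by positivity : 0 ≤ |g x| ^ (q - 2))]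
  refine ⟨i3', ?_⟩
  have hfd : ∀ x, fderiv ℝ (fun x => |g x| ^ (q - 2) * g x) x (Pi.single i 1)
      = (q - 1) * (|g x| ^ (q - 2) * pd i g x) := by
    intro x
    rw [(hder x).fderiv]
    simp only [smul_apply, smul_eq_mul, pd]
    ring
  have key := integral_mul_fderiv_eq_neg_fderiv_mul_of_integrable (μ := volume)
    (f := h) (g := fun x => |g x| ^ (q - 2) * g x) (v := Pi.single i 1)
    (by refine (h1.mul h1 wc wb).congr (Filter.Eventually.of_forall fun x => ?_)
        simp only [hg, pd]; ring)
    (by simp only [hfd]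
        refine (i3.const_mul (q - 1)).congr (Filter.Eventually.of_forall fun x => ?_)
        simp only []; ring)
    (by refine (h0.mul h1 wc wb).congr (Filter.Eventually.of_forall fun x => ?_)
        simp only []; ring)
    (fun x _ => hhd x) (fun x _ => (hder x).differentiableAt)
  simp only [hfd] at key
  have e1 : ∫ x, |g x| ^ q = ∫ x, (fderiv ℝ h x) (Pi.single i 1) * (|g x| ^ (q - 2) * g x) := by
    congr 1
    funext x
    have : |g x| ^ q = |g x| ^ (q - 2) * g x ^ 2 := by
      rw [← sq_abs, ← Real.rpow_natCast (|g x|) 2, ← Real.rpow_add_of_nonneg (abs_nonneg _)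
        (by linarith) (by norm_num)]
      norm_num
    rw [this]
    change _ = g x * _
    ring
  rw [e1, ← neg_eq_iff_eq_neg.mpr key, ← integral_neg, ← integral_const_mul]
  refine ((Real.le_norm_self _).trans (norm_integral_le_integral_norm _)).trans (le_of_eq ?_)
  congr 1
  funext x
  rw [norm_neg, Real.norm_eq_abs, abs_mul, abs_mul, abs_mul,
    abs_of_nonneg (by positivity : 0 ≤ |g x| ^ (q - 2)),
    abs_of_nonneg (by linarith : 0 ≤ q - 1)]
  ring

lemma youngA {r q p : ℝ} (hr : 0 < r) (hq : 2 < q) (hp : 0 < p) (h : 1 / r + 1 / p = 2 / q)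
    {ε : ℝ} (hε : 0 < ε) : ∃ C : ℝ, 0 < C ∧ ∀ a b c : ℝ, 0 ≤ a → 0 ≤ b → 0 ≤ c →
      a * b ^ (q - 2) * c ≤ ε * a ^ r + ε * b ^ q + C * c ^ p := by
  have hq0 : 0 < q := by linarith
  obtain ⟨C, hC, H⟩ := young3 (w1 := 1 / r) (w2 := (q - 2) / q) (w3 := 1 / p) (by positivity)
    (div_pos (by linarith) hq0) (by positivity)
    (by rw [sub_div, div_self hq0.ne']; linarith) hε
  refine ⟨C, hC, fun a b c ha hb hc => ?_⟩
  have := H a (b ^ (q - 2)) c ha (by positivity) hc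
  rw [← Real.rpow_mul hb] at this
  have e : (q - 2) * (1 / ((q - 2) / q)) = q := by
    have : q - 2 ≠ 0 := by linarith
    field_simp
  rw [e] at this
  simpa using this

lemma youngB {q p : ℝ} (hq : 2 < q) (hp : 0 < p) (h : 1 / p = 2 / q)
    {ε : ℝ} (hε : 0 < ε) : ∃ C : ℝ, 0 < C ∧ ∀ a b c : ℝ, 0 ≤ a → a ≤ 1 → 0 ≤ b → 0 ≤ c →
      a * b ^ (q - 2) * c ≤ ε * b ^ q + C * c ^ p := by
  have hq0 : 0 < q := by linarith
  obtain ⟨C, hC, H⟩ := young2 (w2 := (q - 2) / q) (w3 := 1 / p)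
    (div_pos (by linarith) hq0) (by positivity)
    (by rw [sub_div, div_self hq0.ne']; linarith) hε
  refine ⟨C, hC, fun a b c ha ha1 hb hc => ?_⟩
  have := H (b ^ (q - 2)) c (by positivity) hc
  rw [← Real.rpow_mul hb] at this
  have e : (q - 2) * (1 / ((q - 2) / q)) = q := by
    have : q - 2 ≠ 0 := by linarith
    field_simp
  rw [e] at this
  have h1 : a * b ^ (q - 2) * c ≤ b ^ (q - 2) * c := by
    rw [mul_assoc]
    exact mul_le_of_le_one_left (by positivity) ha1
  simp only [one_div_one_div] at this
  linarith

lemma core {n : ℕ} (i : Fin n) {h : (Fin n → ℝ) → ℝ} (hc : ContDiff ℝ (2 : ℕ) h)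
    (h0 : Good h) (h1 : Good (pd i h)) (h2 : Good (pd i (pd i h))) {q p ε C : ℝ} (hq : 2 < q)
    (hp : 2 ≤ p) (A : (Fin n → ℝ) → ℝ) (hA : Integrable A)
    (T : ∀ x, |h x| * |pd i h x| ^ (q - 2) * |pd i (pd i h) x| ≤
      ε * A x + ε * |pd i h x| ^ q + C * |pd i (pd i h) x| ^ p) :
    ∫ x, |pd i h x| ^ q ≤ (q - 1) * (ε * (∫ x, A x) + ε * (∫ x, |pd i h x| ^ q)
      + C * ∫ x, |pd i (pd i h) x| ^ p) := by
  obtain ⟨hi, H⟩ := ibp_ineq i hc h0 h1 h2 hq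
  refine H.trans (mul_le_mul_of_nonneg_left ?_ (by linarith))
  have iA := hA.const_mul ε
  have iB := (h1.rpow hq.le).const_mul ε
  have iC := (h2.rpow hp).const_mul C
  rw [← integral_const_mul, ← integral_const_mul, ← integral_const_mul, ← integral_add iA iB,
    ← integral_add (iA.fun_add iB) iC]
  exact integral_mono hi ((iA.add iB).add iC) T

/-- `f` is `C^m` with all derivatives bounded and square integrable. -/
structure Reg {n : ℕ} (m : ℕ) (f : (Fin n → ℝ) → ℝ) : Prop where
  cd : ContDiff ℝ m f
  good : ∀ w : List (Fin n), w.length ≤ m → Good (DD w f)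

lemma exists_max_word {n : ℕ} (w0 : List (Fin n)) (I : List (Fin n) → ℝ) :
    ∃ w, w.length = w0.length ∧ ∀ w', w'.length = w0.length → I w' ≤ I w :=
  Set.exists_max_image {l : List (Fin n) | l.length = w0.length} I
    (List.finite_length_eq _ _) ⟨w0, rfl⟩

lemma gn_step (n m j : ℕ) (hj : j + 2 ≤ m) : ∃ C : ℝ, 0 < C ∧
    ∀ f : (Fin n → ℝ) → ℝ, Reg m f → (∀ x, |f x| ≤ 1) → ∀ K : ℝ,
      (∀ w : List (Fin n), w.length = j + 2 →
        ∫ x, |DD w f x| ^ (2 * (m : ℝ) / (j + 2 : ℕ)) ≤ K) →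
      ∀ w : List (Fin n), w.length = j + 1 →
        ∫ x, |DD w f x| ^ (2 * (m : ℝ) / (j + 1 : ℕ)) ≤ C * K := by
  induction j with
  | zero =>
    have hm : (2 : ℝ) ≤ m := by exact_mod_cast hj
    set q : ℝ := 2 * (m : ℝ) / (0 + 1 : ℕ) with hqd
    set p : ℝ := 2 * (m : ℝ) / (0 + 2 : ℕ) with hpd
    have hq : 2 < q := by rw [hqd]; push_cast; linarith
    have hp : 2 ≤ p := by rw [hpd]; push_cast; linarith
    obtain ⟨C, hC, HC⟩ := youngB (q := q) (p := p) hq (by linarith)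
      (by rw [hqd, hpd]; push_cast; field_simp; try norm_num) (ε := 1 / (2 * (q - 1)))
      (one_div_pos.mpr (by linarith))
    refine ⟨2 * (q - 1) * C, by have : 0 < q - 1 := by linarith
                                positivity, ?_⟩
    intro f hf hf1 K hK w hw
    obtain ⟨i, w', rfl⟩ : ∃ i w', w = i :: w' := by
      cases w with
      | nil => simp at hw
      | cons i w' => exact ⟨i, w', rfl⟩
    have hw' : w' = [] := by simpa using hw
    subst hw'
    have := core i (h := f) (hf.cd.of_le (by exact_mod_cast hj)) (hf.good [] (by simp))
      (hf.good [i] (by simp; omega)) (hf.good [i, i] (by simpa using hj)) hq hp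
      (fun _ => 0) (integrable_zero _ _ _) (ε := 1 / (2 * (q - 1))) (C := C)
      (fun x => by
        have := HC |f x| |pd i f x| |pd i (pd i f) x| (abs_nonneg _) (hf1 x) (abs_nonneg _)
          (abs_nonneg _)
        linarith)
    have hK' := hK [i, i] rfl
    simp only [DD] at hK' ⊢
    have hq1 : 0 < q - 1 := by linarith
    have e : (q - 1) * (1 / (2 * (q - 1)) * (∫ x : Fin n → ℝ, (0 : ℝ)) + 1 / (2 * (q - 1)) * (∫ x, |pd i f x| ^ q)
      + C * ∫ x, |pd i (pd i f) x| ^ p) = (∫ x, |pd i f x| ^ q) / 2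
        + (q - 1) * C * ∫ x, |pd i (pd i f) x| ^ p := by
      rw [integral_zero]; field_simp; ring
    rw [e] at this
    have h3 := mul_le_mul_of_nonneg_left hK' (by positivity : 0 ≤ (q - 1) * C)
    linarith
  | succ j ih =>
    obtain ⟨C', hC', HC'⟩ := ih (by omega)
    have hm : (j : ℝ) + 1 + 2 ≤ m := by exact_mod_cast hj
    have hj0 : (0 : ℝ) ≤ j := Nat.cast_nonneg j
    have hm0 : (0 : ℝ) < m := by linarith
    set r : ℝ := 2 * (m : ℝ) / (j + 1 : ℕ) with hrd
    set q : ℝ := 2 * (m : ℝ) / (j + 1 + 1 : ℕ) with hqd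
    set p : ℝ := 2 * (m : ℝ) / (j + 1 + 2 : ℕ) with hpd
    have hr : 2 ≤ r := by rw [hrd]; push_cast; rw [le_div_iff₀ (by positivity)]; linarith
    have hq : 2 < q := by rw [hqd]; push_cast; rw [lt_div_iff₀ (by positivity)]; linarith
    have hp : 2 ≤ p := by rw [hpd]; push_cast; rw [le_div_iff₀ (by positivity)]; linarith
    have hq1 : 0 < q - 1 := by linarith
    set ε := 1 / (2 * (q - 1) * (C' + 1)) with hε
    have hε0 : 0 < ε := by positivity
    obtain ⟨C, hC, HC⟩ := youngA (r := r) (q := q) (p := p) (by linarith) hq (by linarith)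
      (by rw [hqd, hpd, hrd]; push_cast; field_simp; ring) hε0
    refine ⟨2 * (q - 1) * C, by positivity, ?_⟩
    intro f hf hf1 K hK w0 hw0
    obtain ⟨w, hw, hmax⟩ := exists_max_word w0 (fun w => ∫ x, |DD w f x| ^ q)
    refine (hmax w0 rfl).trans ?_
    rw [hw0] at hw hmax
    obtain ⟨i, w', rfl⟩ : ∃ i w', w = i :: w' := by
      cases w with
      | nil => simp at hw
      | cons i w' => exact ⟨i, w', rfl⟩
    have hw' : w'.length = j + 1 := by simpa using hw
    have hprev := HC' f hf hf1 _ hmax w' hw'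
    have hK' := hK (i :: i :: w') (by simp [hw'])
    have g0 := hf.good w' (by omega)
    have := core i (h := DD w' f) (DD_contDiff' w' hf.cd (by omega)) g0
      (hf.good (i :: w') (by simp; omega)) (hf.good (i :: i :: w') (by simp; omega)) hq hp
      (fun x => |DD w' f x| ^ r) (g0.rpow hr) (ε := ε) (C := C)
      (fun x => HC _ _ _ (abs_nonneg _) (abs_nonneg _) (abs_nonneg _))
    simp only [DD] at hK' hprev ⊢
    set I := ∫ x, |pd i (DD w' f) x| ^ q
    set J := ∫ x, |pd i (pd i (DD w' f)) x| ^ p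
    set P := ∫ x, |DD w' f x| ^ r
    have e : (q - 1) * (ε * (C' * I) + ε * I + C * K) = I / 2 + (q - 1) * C * K := by
      rw [hε]; field_simp
    have h1 : (q - 1) * (ε * P + ε * I + C * J) ≤ (q - 1) * (ε * (C' * I) + ε * I + C * K) := by
      gcongr
    linarith

lemma gn (n m : ℕ) (d : ℕ) : ∀ j, j + 1 + d = m → ∃ C : ℝ, 0 < C ∧
    ∀ f : (Fin n → ℝ) → ℝ, Reg m f → (∀ x, |f x| ≤ 1) → ∀ K : ℝ,
      (∀ w : List (Fin n), w.length = m → ∫ x, DD w f x ^ 2 ≤ K) →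
      ∀ w : List (Fin n), w.length = j + 1 →
        ∫ x, |DD w f x| ^ (2 * (m : ℝ) / (j + 1 : ℕ)) ≤ C * K := by
  induction d with
  | zero =>
    intro j hj
    refine ⟨1, one_pos, fun f hf hf1 K hK w hw => ?_⟩
    have e : 2 * (m : ℝ) / (j + 1 : ℕ) = 2 := by
      have : (j + 1 : ℕ) = m := by omega
      rw [this]
      have : (m : ℝ) ≠ 0 := by norm_cast; omega
      field_simp
    rw [e, one_mul]
    convert hK w (by omega) using 3
    simp
  | succ d ih =>
    intro j hj
    obtain ⟨C1, h1, H1⟩ := ih (j + 1) (by omega)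
    obtain ⟨C2, h2, H2⟩ := gn_step n m j (by omega)
    refine ⟨C2 * C1, by positivity, fun f hf hf1 K hK w hw => ?_⟩
    rw [mul_assoc]
    exact H2 f hf hf1 _ (H1 f hf hf1 K hK) w hw

lemma DD_zero_of {n : ℕ} (l : List (Fin n)) {f : (Fin n → ℝ) → ℝ} (hf : ∀ x, |f x| ≤ 0) :
    ∀ x, DD l f x = 0 := by
  have : f = fun x => 0 * f x := by
    funext x
    have := abs_nonpos_iff.mp (hf x)
    simp [this]
  intro x
  rw [this, DD_smul]
  simp

lemma Reg.smul {n m : ℕ} {f : (Fin n → ℝ) → ℝ} (hf : Reg m f) (c : ℝ) :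
    Reg m (fun x => c * f x) := by
  refine ⟨contDiff_const.mul hf.cd, fun w hw => ?_⟩
  rw [DD_smul]
  have g := hf.good w hw
  refine ⟨continuous_const.mul g.cont, ?_, ?_⟩
  · obtain ⟨C, hC⟩ := g.bdd
    refine ⟨|c| * C, fun x => ?_⟩
    rw [abs_mul]
    exact mul_le_mul_of_nonneg_left (hC x) (abs_nonneg _)
  · simp only [mul_pow]
    exact g.sq.const_mul _

lemma Good.prod_sq {n : ℕ} {f g : (Fin n → ℝ) → ℝ} (hf : Good f) (hg : Good g) :
    Integrable fun x => (f x * g x) ^ 2 := by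
  obtain ⟨C, hC⟩ := hg.bdd
  refine (hf.mul hf (w := fun x => g x ^ 2) (hg.cont.pow 2) ⟨C ^ 2, fun x => ?_⟩).congr
    (Filter.Eventually.of_forall fun x => ?_)
  · rw [abs_pow]; exact pow_le_pow_left₀ (abs_nonneg _) (hC x) 2
  · simp only []; ring

lemma prod_norm (n j k : ℕ) : ∃ C : ℝ, 0 < C ∧
    ∀ f g : (Fin n → ℝ) → ℝ, Reg (j + 1 + (k + 1)) f → Reg (j + 1 + (k + 1)) g →
      (∀ x, |f x| ≤ 1) → (∀ x, |g x| ≤ 1) → ∀ F G : ℝ,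
      (∀ w : List (Fin n), w.length = j + 1 + (k + 1) → ∫ x, DD w f x ^ 2 ≤ F) →
      (∀ w : List (Fin n), w.length = j + 1 + (k + 1) → ∫ x, DD w g x ^ 2 ≤ G) →
      ∀ a b : List (Fin n), a.length = j + 1 → b.length = k + 1 →
        ∫ x, (DD a f x * DD b g x) ^ 2 ≤ C * (F + G) := by
  obtain ⟨C1, h1, H1⟩ := gn n (j + 1 + (k + 1)) (k + 1) j rfl
  obtain ⟨C2, h2, H2⟩ := gn n (j + 1 + (k + 1)) (j + 1) k (by omega)
  have hj : (0 : ℝ) < (j + 1 : ℕ) := by positivity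
  have hk : (0 : ℝ) < (k + 1 : ℕ) := by positivity
  set m : ℕ := j + 1 + (k + 1) with hmd
  have hm : (m : ℝ) = (j + 1 : ℕ) + (k + 1 : ℕ) := by rw [hmd]; push_cast; ring
  have hm0 : (0 : ℝ) < m := by linarith
  obtain ⟨C3, h3, H3⟩ := young2 (w2 := (j + 1 : ℕ) / (m : ℝ)) (w3 := (k + 1 : ℕ) / (m : ℝ))
    (by positivity) (by positivity) (by rw [← add_div, ← hm, div_self hm0.ne']) one_pos
  refine ⟨C1 + C3 * C2, by positivity, ?_⟩
  intro f g hf hg hf1 hg1 F G hF hG a b ha hb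
  have ga := hf.good a (by omega)
  have gb := hg.good b (by omega)
  have q1 : 2 ≤ 2 * (m : ℝ) / (j + 1 : ℕ) := by rw [le_div_iff₀ hj]; linarith
  have q2 : 2 ≤ 2 * (m : ℝ) / (k + 1 : ℕ) := by rw [le_div_iff₀ hk]; linarith
  have e : ∀ (t : ℕ) (y : ℝ), 0 < (t : ℝ) →
      (y ^ 2) ^ (1 / ((t : ℝ) / (m : ℝ))) = |y| ^ (2 * (m : ℝ) / t) := by
    intro t y ht
    rw [← sq_abs, ← Real.rpow_natCast (|y|) 2, ← Real.rpow_mul (abs_nonneg _)]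
    congr 1
    push_cast
    field_simp
  have ia := ga.rpow q1
  have ib := (gb.rpow q2).const_mul C3
  have hF0 : 0 ≤ F := (integral_nonneg (fun x => sq_nonneg _)).trans
    (hF (a ++ b) (by simp; omega))
  have hG0 : 0 ≤ G := (integral_nonneg (fun x => sq_nonneg _)).trans
    (hG (a ++ b) (by simp; omega))
  have i1 := H1 f hf hf1 F hF a ha
  have i2 := H2 g hg hg1 G hG b hb
  calc ∫ x, (DD a f x * DD b g x) ^ 2
      ≤ ∫ x, (|DD a f x| ^ (2 * (m : ℝ) / (j + 1 : ℕ))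
          + C3 * |DD b g x| ^ (2 * (m : ℝ) / (k + 1 : ℕ))) := by
        refine integral_mono (ga.prod_sq gb) (ia.fun_add ib) (fun x => ?_)
        have := H3 (DD a f x ^ 2) (DD b g x ^ 2) (sq_nonneg _) (sq_nonneg _)
        rw [e _ _ hj, e _ _ hk] at this
        simp only [mul_pow]
        linarith
    _ = (∫ x, |DD a f x| ^ (2 * (m : ℝ) / (j + 1 : ℕ)))
          + C3 * ∫ x, |DD b g x| ^ (2 * (m : ℝ) / (k + 1 : ℕ)) := by
        rw [integral_add ia ib, integral_const_mul]
    _ ≤ C1 * F + C3 * (C2 * G) := by gcongr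
    _ ≤ (C1 + C3 * C2) * (F + G) := by
        have : 0 ≤ C1 * G := by positivity
        have : 0 ≤ C3 * C2 * F := by positivity
        linarith

/-- The product estimate for one pair of orders. -/
def ProdEst (n m j : ℕ) (C : ℝ) : Prop :=
    ∀ f g : (Fin n → ℝ) → ℝ, Reg m f → Reg m g → ∀ A B : ℝ, 0 ≤ A → 0 ≤ B →
      (∀ x, |f x| ≤ A) → (∀ x, |g x| ≤ B) → ∀ F G : ℝ,
      (∀ w : List (Fin n), w.length = m → ∫ x, DD w f x ^ 2 ≤ F) →
      (∀ w : List (Fin n), w.length = m → ∫ x, DD w g x ^ 2 ≤ G) →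
      ∀ a b : List (Fin n), a.length = j → a.length + b.length = m →
        ∫ x, (DD a f x * DD b g x) ^ 2 ≤ C * (A ^ 2 * G + B ^ 2 * F)

lemma bdd_prod {n : ℕ} {f g : (Fin n → ℝ) → ℝ} {A : ℝ} (hf : ∀ x, |f x| ≤ A)
    (hg : Integrable fun x => g x ^ 2) :
    ∫ x, (f x * g x) ^ 2 ≤ A ^ 2 * ∫ x, g x ^ 2 := by
  rw [← integral_const_mul]
  refine integral_mono_of_nonneg (Filter.Eventually.of_forall fun x => sq_nonneg _)
    (hg.const_mul _) (Filter.Eventually.of_forall fun x => ?_)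
  simp only [mul_pow]
  have : f x ^ 2 ≤ A ^ 2 := by
    rw [← sq_abs]; exact pow_le_pow_left₀ (abs_nonneg _) (hf x) 2
  gcongr

lemma prod_est (n m j : ℕ) : ∃ C : ℝ, 0 < C ∧ ProdEst n m j C := by
  obtain ⟨C0, hC0, H⟩ := prod_norm n (j - 1) (m - j - 1)
  refine ⟨max C0 1, by positivity, ?_⟩
  intro f g hf hg A B hA hB hfA hgB F G hF hG a b ha hab
  have hF0 : 0 ≤ F := (integral_nonneg (fun x => sq_nonneg _)).trans
    (hF (a ++ b) (by simp; omega))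
  have hG0 : 0 ≤ G := (integral_nonneg (fun x => sq_nonneg _)).trans
    (hG (a ++ b) (by simp; omega))
  have hP : 0 ≤ A ^ 2 * G + B ^ 2 * F := by positivity
  have hone : A ^ 2 * G + B ^ 2 * F ≤ max C0 1 * (A ^ 2 * G + B ^ 2 * F) :=
    le_mul_of_one_le_left hP (le_max_right _ _)
  rcases Nat.eq_zero_or_pos a.length with h0 | hapos
  · have : a = [] := List.length_eq_zero_iff.mp h0
    subst this
    refine le_trans ?_ hone
    have h1 := bdd_prod (g := DD b g) hfA (hg.good b (by omega)).sq
    have h2 := mul_le_mul_of_nonneg_left (hG b (by simpa using hab)) (sq_nonneg A)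
    have h3 : 0 ≤ B ^ 2 * F := by positivity
    simp only [DD]
    linarith
  rcases Nat.eq_zero_or_pos b.length with h0 | hbpos
  · have : b = [] := List.length_eq_zero_iff.mp h0
    subst this
    refine le_trans ?_ hone
    have h1 := bdd_prod (g := DD a f) hgB (hf.good a (by omega)).sq
    have h2 := mul_le_mul_of_nonneg_left (hF a (by simpa using hab)) (sq_nonneg B)
    have h3 : 0 ≤ A ^ 2 * G := by positivity
    simp only [DD]
    simp only [mul_comm (g _)] at h1
    linarith
  rcases hA.eq_or_lt with rfl | hA
  · have := DD_zero_of a hfA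
    simp only [this]
    simpa using hP.trans hone
  rcases hB.eq_or_lt with rfl | hB
  · have := DD_zero_of b hgB
    simp only [this]
    simpa using hP.trans hone
  have em : j - 1 + 1 + (m - j - 1 + 1) = m := by omega
  rw [em] at H
  have hsc : ∀ (D : ℝ) (φ : (Fin n → ℝ) → ℝ) (K : ℝ),
      (∀ w : List (Fin n), w.length = m → ∫ x, DD w φ x ^ 2 ≤ K) →
      (∀ w : List (Fin n), w.length = m →
        ∫ x, DD w (fun y => D⁻¹ * φ y) x ^ 2 ≤ (D⁻¹) ^ 2 * K) := by
    intro D φ K h w hw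
    rw [DD_smul]
    simp only [mul_pow]
    rw [integral_const_mul]
    exact mul_le_mul_of_nonneg_left (h w hw) (sq_nonneg _)
  have hbd : ∀ (D : ℝ) (φ : (Fin n → ℝ) → ℝ), 0 < D → (∀ x, |φ x| ≤ D) →
      ∀ x, |D⁻¹ * φ x| ≤ 1 := by
    intro D φ hD h x
    rw [abs_mul, abs_of_pos (inv_pos.mpr hD), inv_mul_le_iff₀ hD, mul_one]
    exact h x
  have key := H _ _ (hf.smul A⁻¹) (hg.smul B⁻¹) (hbd A f hA hfA) (hbd B g hB hgB) _ _
    (hsc A f F hF) (hsc B g G hG) a b (by omega) (by omega)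
  simp only [DD_smul] at key
  have e : ∀ x, (A⁻¹ * DD a f x * (B⁻¹ * DD b g x)) ^ 2
      = (A⁻¹ * B⁻¹) ^ 2 * (DD a f x * DD b g x) ^ 2 := fun x => by ring
  simp only [e] at key
  rw [integral_const_mul] at key
  have k2 := mul_le_mul_of_nonneg_left key (sq_nonneg (A * B))
  have e1 : (A * B) ^ 2 * ((A⁻¹ * B⁻¹) ^ 2 * ∫ x, (DD a f x * DD b g x) ^ 2)
      = ∫ x, (DD a f x * DD b g x) ^ 2 := by field_simp
  have e2 : (A * B) ^ 2 * (C0 * ((A⁻¹) ^ 2 * F + (B⁻¹) ^ 2 * G))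
      = C0 * (A ^ 2 * G + B ^ 2 * F) := by field_simp; ring
  rw [e1, e2] at k2
  exact k2.trans (mul_le_mul_of_nonneg_right (le_max_left _ _) hP)

lemma ProdEst.mono {n m j : ℕ} {C C' : ℝ} (h : ProdEst n m j C) (hC : C ≤ C') :
    ProdEst n m j C' := by
  intro f g hf hg A B hA hB hfA hgB F G hF hG a b ha hab
  have hF0 : 0 ≤ F := (integral_nonneg (fun x => sq_nonneg _)).trans
    (hF (a ++ b) (by simp; omega))
  have hG0 : 0 ≤ G := (integral_nonneg (fun x => sq_nonneg _)).trans
    (hG (a ++ b) (by simp; omega))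
  exact (h f g hf hg A B hA hB hfA hgB F G hF hG a b ha hab).trans
    (mul_le_mul_of_nonneg_right hC (by positivity))

lemma prod_est_unif (n s : ℕ) : ∃ C : ℝ, 0 < C ∧ ∀ m ≤ s, ∀ j ≤ s, ProdEst n m j C := by
  choose C hC H using fun m j => prod_est n m j
  refine ⟨∑ m ∈ range (s + 1), ∑ j ∈ range (s + 1), C m j, ?_, ?_⟩
  · exact Finset.sum_pos (fun m _ => Finset.sum_pos (fun j _ => hC m j) ⟨0, by simp⟩)
      ⟨0, by simp⟩
  · intro m hm j hj
    refine (H m j).mono ?_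
    calc C m j ≤ ∑ j ∈ range (s + 1), C m j :=
          Finset.single_le_sum (f := fun j => C m j) (fun j _ => (hC m j).le)
            (Finset.mem_range.mpr (by omega))
      _ ≤ _ := Finset.single_le_sum (f := fun m => ∑ j ∈ range (s + 1), C m j)
          (fun m _ => Finset.sum_nonneg fun j _ => (hC m j).le) (Finset.mem_range.mpr (by omega))

lemma list_L2 {n : ℕ} {ι : Type} (L : List ι) (φ : ι → (Fin n → ℝ) → ℝ) (Q : ℝ)
    (hi : ∀ p ∈ L, Integrable fun x => φ p x ^ 2) (hQ : ∀ p ∈ L, ∫ x, φ p x ^ 2 ≤ Q) :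
    ∫ x, (L.map fun p => φ p x).sum ^ 2 ≤ (L.length : ℝ) ^ 2 * Q := by
  have e : ∀ x, (L.map fun p => φ p x).sum = ∑ i : Fin L.length, φ L[i] x := fun x =>
    (Fin.sum_univ_fun_getElem L (fun p => φ p x)).symm
  simp only [e]
  have hi' : ∀ i : Fin L.length, Integrable fun x => φ L[i] x ^ 2 := fun i =>
    hi _ (List.getElem_mem _)
  calc ∫ x, (∑ i : Fin L.length, φ L[i] x) ^ 2
      ≤ ∫ x, (L.length : ℝ) * ∑ i : Fin L.length, φ L[i] x ^ 2 := by
        refine integral_mono_of_nonneg (Filter.Eventually.of_forall fun x => sq_nonneg _)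
          ((integrable_finset_sum _ fun i _ => hi' i).const_mul _)
          (Filter.Eventually.of_forall fun x => ?_)
        have := sq_sum_le_card_mul_sum_sq (s := (Finset.univ : Finset (Fin L.length)))
          (f := fun i => φ L[i] x)
        simpa using this
    _ = (L.length : ℝ) * ∑ i : Fin L.length, ∫ x, φ L[i] x ^ 2 := by
        rw [integral_const_mul, integral_finset_sum _ fun i _ => hi' i]
    _ ≤ (L.length : ℝ) * ∑ i : Fin L.length, Q := by
        gcongr with i
        exact hQ _ (List.getElem_mem _)
    _ = _ := by simp; ring

lemma reg_of {n s : ℕ} {f : (Fin n → ℝ) → ℝ} (hf : ContDiff ℝ s f)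
    (h : ∀ α ∈ multiIndices n s,
      (∃ C, ∀ x, |mderiv α f x| ≤ C) ∧ Integrable fun x => mderiv α f x ^ 2) : Reg s f := by
  refine ⟨hf, fun w hw => ?_⟩
  have hc : ContDiff ℝ (0 : ℕ) (DD w f) := DD_contDiff' w hf (by omega)
  obtain ⟨α, h1, h2⟩ := DD_eq_mderiv w hf hw
  obtain ⟨h3, h4⟩ := h α ((mem_multiIndices α).mpr (by omega))
  rw [← h2] at h3 h4
  exact ⟨hc.continuous, h3, h4⟩

lemma Reg.mono {n s m : ℕ} {f : (Fin n → ℝ) → ℝ} (hf : Reg s f) (h : m ≤ s) : Reg m f :=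
  ⟨hf.cd.of_le (by exact_mod_cast h), fun w hw => hf.good w (by omega)⟩

lemma Reg.pd {n s : ℕ} {f : (Fin n → ℝ) → ℝ} (hf : Reg (s + 1) f) (i : Fin n) :
    Reg s (pd i f) := by
  refine ⟨pd_contDiff i hf.cd, fun w hw => ?_⟩
  have := hf.good (w ++ [i]) (by simp; omega)
  rwa [DD_append] at this

lemma word_le_sob {n s t : ℕ} {f : (Fin n → ℝ) → ℝ} (hf : ContDiff ℝ s f) (w : List (Fin n))
    (hw : w.length ≤ t) (ht : t ≤ s) : ∫ x, DD w f x ^ 2 ≤ sobNorm n t f ^ 2 := by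
  obtain ⟨α, h1, h2⟩ := DD_eq_mderiv w hf (by omega)
  rw [h2, sobNorm, Real.sq_sqrt
    (Finset.sum_nonneg fun α _ => integral_nonneg fun x => sq_nonneg _)]
  exact Finset.single_le_sum (f := fun α => ∫ x, mderiv α f x ^ 2)
    (fun α _ => integral_nonneg fun x => sq_nonneg _) ((mem_multiIndices α).mpr (by omega))

lemma le_Linf {n : ℕ} {f : (Fin n → ℝ) → ℝ} (hf : Good f) (x : Fin n → ℝ) :
    |f x| ≤ LinfNorm f := by
  obtain ⟨C, hC⟩ := hf.bdd
  exact le_ciSup (f := fun x => |f x|) ⟨C, by rintro _ ⟨y, rfl⟩; exact hC y⟩ x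

/-- Moser-type commutator estimate. -/
theorem moser_commutator (n s : ℕ) (hn : 1 ≤ n) (hs : 1 ≤ s) :
    ∃ c : ℝ, 0 < c ∧
      ∀ u v : (Fin n → ℝ) → ℝ,
        ContDiff ℝ s u → ContDiff ℝ s v →
        (∀ α ∈ multiIndices n s,
          (∃ C, ∀ x, |mderiv α u x| ≤ C) ∧ Integrable fun x => mderiv α u x ^ 2) →
        (∀ α ∈ multiIndices n s,
          (∃ C, ∀ x, |mderiv α v x| ≤ C) ∧ Integrable fun x => mderiv α v x ^ 2) →
        ∀ α ∈ multiIndices n s,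
          L2norm (fun x => mderiv α (fun y => u y * v y) x - u x * mderiv α v x) ≤
            c * ((⨆ i : Fin n, LinfNorm (pd i u)) * sobNorm n (s - 1) v
              + LinfNorm v * sobNorm n s u) := by
  obtain ⟨C, hC, HC⟩ := prod_est_unif n s
  refine ⟨2 ^ s * Real.sqrt C, by positivity, ?_⟩
  intro u v hu hv hu' hv' α hα
  rw [mem_multiIndices] at hα
  have ru := reg_of hu hu'
  have rv := reg_of hv hv'
  obtain ⟨t, rfl⟩ : ∃ t, s = t + 1 := ⟨s - 1, by omega⟩
  rw [Nat.add_sub_cancel]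
  set A := ⨆ i : Fin n, LinfNorm (pd i u) with hA
  set B := LinfNorm v with hB
  have hB0 : 0 ≤ B := Real.iSup_nonneg fun x => abs_nonneg _
  have hA0 : 0 ≤ A := Real.iSup_nonneg fun i => Real.iSup_nonneg fun x => abs_nonneg _
  have hS0 : 0 ≤ sobNorm n t v := Real.sqrt_nonneg _
  have hT0 : 0 ≤ sobNorm n (t + 1) u := Real.sqrt_nonneg _
  obtain ⟨L, h1, h2, h3⟩ := leibniz (wordOf α)
  rw [length_wordOf] at h1 h2 h3
  have hle : ((∑ i, α i : ℕ) : WithTop ℕ∞) ≤ ((t + 1 : ℕ) : WithTop ℕ∞) := by exact_mod_cast hα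
  have e : ∀ x, mderiv α (fun y => u y * v y) x - u x * mderiv α v x
      = (L.map fun p => DD p.1 u x * DD p.2 v x).sum := by
    intro x
    rw [mderiv_eq, mderiv_eq, h3 u v (hu.of_le hle) (hv.of_le hle)]
    ring
  set Q := C * (A ^ 2 * sobNorm n t v ^ 2 + B ^ 2 * sobNorm n (t + 1) u ^ 2) with hQ
  have hQ0 : 0 ≤ Q := by positivity
  have main := list_L2 L (fun p x => DD p.1 u x * DD p.2 v x) Q
    (fun p hp => by
      have := h1 p hp
      exact (ru.good p.1 (by omega)).prod_sq (rv.good p.2 (by omega)))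
    (fun p hp => by
      obtain ⟨hne, hlen⟩ := h1 p hp
      obtain ⟨a, b⟩ := p
      simp only at hne hlen ⊢
      rcases List.eq_nil_or_concat a with h | ⟨a', i, rfl⟩
      · exact absurd h hne
      simp only [List.concat_eq_append, List.length_append, List.length_singleton] at hlen ⊢
      rw [DD_append]
      have rp := ru.pd i
      refine HC (a'.length + b.length) (by omega) a'.length (by omega) (pd i u) v
        (rp.mono (by omega)) (rv.mono (by omega)) A B hA0 hB0 (fun x => ?_)
        (le_Linf (rv.good [] (by simp))) _ _ (fun w hw => ?_)
        (fun w hw => word_le_sob hv w (by omega) (by omega)) a' b rfl rfl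
      · exact (le_Linf (ru.good [i] (by simp)) x).trans
          (le_ciSup (f := fun i => LinfNorm (pd i u)) (Set.finite_range _).bddAbove i)
      · have := word_le_sob hu (w ++ [i]) (t := t + 1) (by simp; omega) le_rfl
        rwa [DD_append] at this)
  have hL : (L.length : ℝ) ≤ 2 ^ (t + 1) := by
    have : L.length ≤ 2 ^ (t + 1) :=
      (by omega : L.length ≤ 2 ^ (∑ i, α i)).trans (Nat.pow_le_pow_right (by norm_num) hα)
    exact_mod_cast this
  simp only [L2norm, e]
  apply Real.sqrt_le_iff.mpr
  refine ⟨by positivity, main.trans ?_⟩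
  have hq : Q ≤ C * (A * sobNorm n t v + B * sobNorm n (t + 1) u) ^ 2 := by
    rw [hQ]
    gcongr
    have : 0 ≤ A * sobNorm n t v * (B * sobNorm n (t + 1) u) := by positivity
    nlinarith
  calc (L.length : ℝ) ^ 2 * Q
      ≤ (2 ^ (t + 1)) ^ 2 * (C * (A * sobNorm n t v + B * sobNorm n (t + 1) u) ^ 2) := by
        gcongr
    _ = _ := by
        rw [mul_pow, mul_pow, Real.sq_sqrt hC.le]; ring
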